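/- If a finitely generated group G contains a nilpotent subgroup of finite index, then G has polynomial growth. -/

import Mathlib

open scoped BigOperators

/-- The ball of radius `n` in a group `G` with respect to a set `S`:
elements expressible as a product of at most `n` elements of `S`. -/
def ball {G : Type*} [Group G] (S : Set G) (n : ℕ) : Set G :=
  {g | ∃ l : List G, (∀ x ∈ l, x ∈ S) ∧ l.length ≤ n ∧ l.prod = g}

/-- The growth function of `G` relative to `S`: `γ_S(n) = |B_S(n)|`. -/
noncomputable def growth {G : Type*} [Group G] (S : Set G) (n : ℕ) : ℕ := (ball S n).ncard

/-- A finite symmetric generating set of `G`. -/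
def IsSymmGen {G : Type*} [Group G] (S : Finset G) : Prop :=
  (∀ x ∈ S, x⁻¹ ∈ S) ∧ Subgroup.closure (S : Set G) = ⊤

/-- `G` has polynomial growth: for some finite symmetric generating set `S`
there are `C > 0` and `k : ℕ` with `γ_S(n) ≤ C * n ^ k` for all `n ≥ 1`. -/
def HasPolyGrowth (G : Type*) [Group G] : Prop :=
  ∃ S : Finset G, IsSymmGen S ∧ ∃ C : ℝ, 0 < C ∧ ∃ k : ℕ,
    ∀ n : ℕ, 1 ≤ n → (growth (S : Set G) n : ℝ) ≤ C * (n : ℝ) ^ k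

theorem Polynomial.eval_mono_nat (p : Polynomial ℕ) : Monotone fun n : ℕ => p.eval n := by
  intro m n hmn
  simp only [Polynomial.eval_eq_sum_range]
  gcongr

theorem Polynomial.exists_eval_le_mul_pow_nat (p : Polynomial ℕ) :
    ∃ C k : ℕ, 0 < C ∧ ∀ n : ℕ, 1 ≤ n → p.eval n ≤ C * n ^ k := by
  refine ⟨∑ i ∈ Finset.range (p.natDegree + 1), p.coeff i + 1, p.natDegree, by simp, fun n hn => ?_⟩
  rw [Polynomial.eval_eq_sum_range, add_mul, Finset.sum_mul]
  refine le_add_right (Finset.sum_le_sum fun i hi => ?_)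
  gcongr
  exact Nat.lt_succ_iff.mp (Finset.mem_range.mp hi)

section Ball

open scoped commutatorElement

variable {G : Type*} [Group G] {S : Set G}

theorem one_mem_ball (S : Set G) (n : ℕ) : (1 : G) ∈ ball S n :=
  ⟨[], by simp, by simp, rfl⟩

theorem ball_mono {m n : ℕ} (h : m ≤ n) : ball S m ⊆ ball S n :=
  fun _ ⟨l, hl, hlen, hp⟩ => ⟨l, hl, hlen.trans h, hp⟩

theorem mul_mem_ball {g h : G} {m n : ℕ} (hg : g ∈ ball S m) (hh : h ∈ ball S n) :
    g * h ∈ ball S (m + n) := by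
  obtain ⟨l, hl, hlen, rfl⟩ := hg
  obtain ⟨l', hl', hlen', rfl⟩ := hh
  refine ⟨l ++ l', fun x hx => ?_, by simp; lia, by simp⟩
  rcases List.mem_append.mp hx with hx | hx
  exacts [hl x hx, hl' x hx]

/-- Induction on the ball, a word growing by letters added on the left. -/
theorem ball_induction {P : ℕ → G → Prop} (one : ∀ n, P n 1)
    (mul : ∀ n s g, s ∈ S → P n g → P (n + 1) (s * g)) {n : ℕ} {g : G} (hg : g ∈ ball S n) :
    P n g := by
  obtain ⟨l, hl, hlen, rfl⟩ := hg
  induction l generalizing n with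
  | nil => exact one n
  | cons s l ih =>
    obtain ⟨n, rfl⟩ : ∃ m, n = m + 1 := ⟨n - 1, by simp at hlen; lia⟩
    rw [List.prod_cons]
    exact mul n s _ (hl s (by simp)) (ih (fun x hx => hl x (by simp [hx])) (by simpa using hlen))

theorem finite_ball (hS : S.Finite) (n : ℕ) : (ball S n).Finite := by
  induction n with
  | zero =>
    refine (Set.finite_singleton (1 : G)).subset ?_
    rintro g ⟨l, -, hlen, rfl⟩
    simp [List.length_eq_zero_iff.mp (Nat.le_zero.mp hlen)]
  | succ n ih =>
    refine ((hS.image2 (· * ·) ih).insert 1).subset ?_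
    rintro g ⟨l, hl, hlen, rfl⟩
    cases l with
    | nil => simp
    | cons s l =>
      exact Or.inr ⟨s, hl s (by simp), l.prod,
        ⟨l, fun x hx => hl x (by simp [hx]), by simpa using hlen, rfl⟩, by simp⟩

theorem exists_mem_ball_of_mem_closure (hinv : ∀ x ∈ S, x⁻¹ ∈ S) {g : G}
    (hg : g ∈ Subgroup.closure S) : ∃ n, g ∈ ball S n := by
  rw [← Subgroup.mem_toSubmonoid, Subgroup.closure_toSubmonoid] at hg
  obtain ⟨l, hl, rfl⟩ := Submonoid.exists_list_of_mem_closure hg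
  refine ⟨l.length, l, fun x hx => ?_, le_rfl, rfl⟩
  rcases hl x hx with h | h
  · exact h
  · simpa using hinv _ h

/-- The conjugates of `m` by the powers of `a` have polynomial word length in a normal subgroup,
if `m` lies in a term of the upper central series. -/
theorem exists_pow_conj_mem_ball (hinv : ∀ x ∈ S, x⁻¹ ∈ S) [hn : (Subgroup.closure S).Normal]
    (a : G) (i : ℕ) {m : G} (hm : m ∈ Subgroup.closure S)
    (hi : m ∈ Subgroup.upperCentralSeries G i) :
    ∃ p : Polynomial ℕ, ∀ j : ℕ, a ^ j * m * (a ^ j)⁻¹ ∈ ball S (p.eval j) := by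
  induction i generalizing m with
  | zero =>
    obtain rfl : m = 1 := by simpa using hi
    exact ⟨0, fun j => by simpa using one_mem_ball S 0⟩
  | succ i ih =>
    have hc : a * m * a⁻¹ * m⁻¹ ∈ Subgroup.upperCentralSeries G i := by
      have := inv_mem (Subgroup.mem_upperCentralSeries_succ_iff.mp hi a)
      rwa [commutatorElement_inv] at this
    obtain ⟨p, hp⟩ := ih (mul_mem (hn.conj_mem m hm a) (inv_mem hm)) hc
    obtain ⟨L, hL⟩ := exists_mem_ball_of_mem_closure hinv hm
    refine ⟨Polynomial.X * p + Polynomial.C L, fun j => ?_⟩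
    induction j with
    | zero => simpa using hL
    | succ j ihj =>
      have e : a ^ (j + 1) * m * (a ^ (j + 1))⁻¹ =
          (a ^ j * (a * m * a⁻¹ * m⁻¹) * (a ^ j)⁻¹) * (a ^ j * m * (a ^ j)⁻¹) := by
        rw [pow_succ]; group
      rw [e]
      refine ball_mono ?_ (mul_mem_ball (hp j) ihj)
      have hmono : p.eval j ≤ p.eval (j + 1) := p.eval_mono_nat (Nat.le_succ j)
      simp only [Polynomial.eval_add, Polynomial.eval_mul, Polynomial.eval_X, Polynomial.eval_C]
      nlinarith

theorem exists_zpow_conj_mem_ball (hS : S.Finite) (hinv : ∀ x ∈ S, x⁻¹ ∈ S)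
    [(Subgroup.closure S).Normal] [Group.IsNilpotent G] (a : G) :
    ∃ p : Polynomial ℕ, ∀ t ∈ S, ∀ n : ℕ, ∀ j : ℤ, j.natAbs ≤ n →
      a ^ j * t * (a ^ j)⁻¹ ∈ ball S (p.eval n) := by
  obtain ⟨c, hc⟩ := Group.IsNilpotent.nilpotent G
  have key : ∀ t : G, ∃ p : Polynomial ℕ, t ∈ S → ∀ n : ℕ, ∀ j : ℤ, j.natAbs ≤ n →
      a ^ j * t * (a ^ j)⁻¹ ∈ ball S (p.eval n) := by
    intro t
    by_cases ht : t ∈ S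
    · have htc := Subgroup.subset_closure ht
      have hti : t ∈ Subgroup.upperCentralSeries G c := by simp [hc]
      obtain ⟨p, hp⟩ := exists_pow_conj_mem_ball hinv a c htc hti
      obtain ⟨q, hq⟩ := exists_pow_conj_mem_ball hinv a⁻¹ c htc hti
      refine ⟨p + q, fun _ n j hj => ?_⟩
      have hpm := p.eval_mono_nat hj
      have hqm := q.eval_mono_nat hj
      rw [Polynomial.eval_add]
      obtain h | h := Int.natAbs_eq j
      · refine ball_mono (le_add_right hpm) ?_
        have := hp j.natAbs
        rwa [← zpow_natCast, ← h] at this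
      · refine ball_mono (le_add_left hqm) ?_
        have := hq j.natAbs
        rwa [inv_pow, ← zpow_natCast, ← zpow_neg, ← h] at this
    · exact ⟨0, fun h => absurd h ht⟩
  choose p hp using key
  refine ⟨∑ t ∈ hS.toFinset, p t, fun t ht n j hj => ball_mono ?_ (hp t ht n j hj)⟩
  rw [Polynomial.eval_finsetSum]
  exact Finset.single_le_sum (f := fun t => (p t).eval n) (fun _ _ => Nat.zero_le _)
    (hS.mem_toFinset.mpr ht)

/-- A finite symmetric set that generates a normal subgroup and whose balls have polynomially
bounded cardinality. -/
structure IsPolyGrowthSet (S : Set G) : Prop where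
  finite : S.Finite
  inv_mem : ∀ x ∈ S, x⁻¹ ∈ S
  normal : (Subgroup.closure S).Normal
  growth_le : ∃ p : Polynomial ℕ, ∀ n, growth S n ≤ p.eval n

theorem isPolyGrowthSet_empty : IsPolyGrowthSet (∅ : Set G) where
  finite := Set.finite_empty
  inv_mem := by simp
  normal := by rw [Subgroup.closure_empty]; infer_instance
  growth_le := by
    refine ⟨1, fun n => ?_⟩
    rw [Polynomial.eval_one]
    refine (Set.ncard_le_ncard (t := {1}) fun g hg => ?_).trans (Set.ncard_singleton _).le
    exact ball_induction (P := fun _ g => g ∈ ({1} : Set G)) (by simp) (by simp) hg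

open scoped Pointwise in
theorem exists_growth_union_pair_le (hS : S.Finite) (hinv : ∀ x ∈ S, x⁻¹ ∈ S)
    [(Subgroup.closure S).Normal] [Group.IsNilpotent G] (a : G) :
    ∃ p : Polynomial ℕ, ∀ n, growth (S ∪ {a, a⁻¹}) n ≤ (2 * n + 1) * growth S (n * p.eval n) := by
  obtain ⟨p, hp⟩ := exists_zpow_conj_mem_ball hS hinv a
  refine ⟨p, fun n => ?_⟩
  set Z : Set G := (fun j : ℤ => a ^ j) '' (Finset.Icc (-n : ℤ) n : Set ℤ)
  have hZfin : Z.Finite := (Finset.finite_toSet _).image _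
  have hZcard : Z.ncard ≤ 2 * n + 1 := by
    refine (Set.ncard_image_le (Finset.finite_toSet _)).trans ?_
    rw [Set.ncard_coe_finset, Int.card_Icc]
    lia
  have hsub : ball (S ∪ {a, a⁻¹}) n ⊆ Z * ball S (n * p.eval n) := by
    intro g hg
    have := ball_induction (P := fun m g => m ≤ n → ∃ j : ℤ, j.natAbs ≤ m ∧
      ∃ h ∈ ball S (m * p.eval n), g = a ^ j * h) ?_ ?_ hg le_rfl
    · obtain ⟨j, hj, h, hh, rfl⟩ := this
      refine Set.mul_mem_mul ⟨j, ?_, rfl⟩ hh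
      simp only [Finset.coe_Icc, Set.mem_Icc]
      lia
    · exact fun m _ => ⟨0, by simp, 1, one_mem_ball _ _, by simp⟩
    · rintro m s g (hs | rfl | rfl) ih hm
      · obtain ⟨j, hj, h, hh, rfl⟩ := ih (by lia)
        refine ⟨j, by lia, a ^ (-j) * s * (a ^ (-j))⁻¹ * h, ?_, by group⟩
        have := mul_mem_ball (hp s hs n (-j) (by lia)) hh
        rwa [add_comm, ← Nat.succ_mul] at this
      · obtain ⟨j, hj, h, hh, rfl⟩ := ih (by lia)
        exact ⟨1 + j, by lia, h, ball_mono (by gcongr; lia) hh, by rw [zpow_one_add, mul_assoc]⟩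
      · obtain ⟨j, hj, h, hh, rfl⟩ := ih (by lia)
        exact ⟨-1 + j, by lia, h, ball_mono (by gcongr; lia) hh,
          by rw [zpow_add, zpow_neg_one, mul_assoc]⟩
  calc growth (S ∪ {a, a⁻¹}) n
      ≤ (Z * ball S (n * p.eval n)).ncard :=
        Set.ncard_le_ncard hsub (hZfin.mul (finite_ball hS _))
    _ ≤ Z.ncard * (ball S (n * p.eval n)).ncard := Set.natCard_mul_le
    _ ≤ _ := Nat.mul_le_mul_right _ hZcard

theorem IsPolyGrowthSet.union_pair [Group.IsNilpotent G] (hS : IsPolyGrowthSet S) {a : G}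
    (ha : ∀ g : G, ⁅g, a⁆ ∈ Subgroup.closure S) : IsPolyGrowthSet (S ∪ {a, a⁻¹}) where
  finite := hS.finite.union (by simp)
  inv_mem := by
    rintro x (hx | rfl | rfl)
    · exact Or.inl (hS.inv_mem x hx)
    · simp
    · simp
  normal := by
    have hle : Subgroup.closure S ≤ Subgroup.closure (S ∪ {a, a⁻¹}) :=
      Subgroup.closure_mono Set.subset_union_left
    have hmem : a ∈ Subgroup.closure (S ∪ {a, a⁻¹}) := Subgroup.subset_closure (by simp)
    have hconj (g : G) : g * a * g⁻¹ ∈ Subgroup.closure (S ∪ {a, a⁻¹}) := by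
      have := mul_mem (hle (ha g)) hmem
      rwa [commutatorElement_def, inv_mul_cancel_right] at this
    rw [← Subgroup.normalizer_eq_top_iff, eq_top_iff, Subgroup.le_normalizer_closure_iff]
    rintro g - x (hx | rfl | rfl)
    · exact hle (hS.normal.conj_mem x (Subgroup.subset_closure hx) g)
    · exact hconj g
    · rw [← conj_inv]
      exact Subgroup.inv_mem _ (hconj g)
  growth_le := by
    have := hS.normal
    obtain ⟨p, hp⟩ := exists_growth_union_pair_le hS.finite hS.inv_mem a
    obtain ⟨q, hq⟩ := hS.growth_le
    refine ⟨(2 * Polynomial.X + 1) * q.comp (Polynomial.X * p), fun n => (hp n).trans ?_⟩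
    simpa using Nat.mul_le_mul_left (2 * n + 1) (hq (n * p.eval n))

theorem IsPolyGrowthSet.exists_superset [Group.IsNilpotent G] (hS : IsPolyGrowthSet S) {F : Set G}
    (hF : F.Finite) (h : ∀ a ∈ F, ∀ g : G, ⁅g, a⁆ ∈ Subgroup.closure S) :
    ∃ T, S ⊆ T ∧ F ⊆ T ∧ IsPolyGrowthSet T := by
  induction F, hF using Set.Finite.induction_on with
  | empty => exact ⟨S, subset_rfl, by simp, hS⟩
  | @insert a F _ _ ih =>
    obtain ⟨T, hST, hFT, hT⟩ := ih fun b hb => h b (Or.inr hb)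
    refine ⟨T ∪ {a, a⁻¹}, hST.trans Set.subset_union_left, ?_,
      hT.union_pair fun g => Subgroup.closure_mono hST (h a (by simp) g)⟩
    exact Set.insert_subset (by simp) (hFT.trans Set.subset_union_left)

theorem commutatorElement_mem_of_closure_eq_top {N : Subgroup G} [N.Normal]
    (hS : Subgroup.closure S = ⊤) {a : G} (h : ∀ s ∈ S, ⁅s, a⁆ ∈ N) (g : G) : ⁅g, a⁆ ∈ N := by
  have hN (x : G) : ⁅x, a⁆ ∈ N ↔
      x ∈ (Subgroup.centralizer {(a : G ⧸ N)}).comap (QuotientGroup.mk' N) := by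
    rw [← QuotientGroup.eq_one_iff, Subgroup.mem_comap, Subgroup.mem_centralizer_singleton_iff,
      ← commutatorElement_eq_one_iff_mul_comm]
    rfl
  have hle := (Subgroup.closure_le _).mpr fun s hs => (hN s).mp (h s hs)
  exact (hN g).mpr (hle (hS ▸ Subgroup.mem_top g))

theorem exists_isPolyGrowthSet_superset [Group.IsNilpotent G] (hfin : S.Finite)
    (hS : Subgroup.closure S = ⊤) (i : ℕ) {F : Set G} (hF : F.Finite)
    (hFi : F ⊆ Subgroup.upperCentralSeries G i) : ∃ T, F ⊆ T ∧ IsPolyGrowthSet T := by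
  induction i generalizing F with
  | zero =>
    obtain ⟨T, -, hFT, hT⟩ := isPolyGrowthSet_empty.exists_superset hF fun a ha g => by
      obtain rfl : a = 1 := by simpa using hFi ha
      simp
    exact ⟨T, hFT, hT⟩
  | succ i ih =>
    obtain ⟨T, hFT, hT⟩ := ih (hfin.image2 (fun s a => ⁅s, a⁆) hF) (by
      rintro _ ⟨s, -, a, ha, rfl⟩
      change ⁅s, a⁆ ∈ _
      rw [← commutatorElement_inv]
      exact inv_mem (Subgroup.mem_upperCentralSeries_succ_iff.mp (hFi ha) s))
    have := hT.normal
    obtain ⟨U, -, hFU, hU⟩ := hT.exists_superset hF fun a ha =>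
      commutatorElement_mem_of_closure_eq_top hS fun s hs =>
        Subgroup.subset_closure (hFT ⟨s, hs, a, ha, rfl⟩)
    exact ⟨U, hFU, hU⟩

theorem exists_isPolyGrowthSet_closure_eq_top [Group.IsNilpotent G] [hG : Group.FG G] :
    ∃ T : Set G, Subgroup.closure T = ⊤ ∧ IsPolyGrowthSet T := by
  obtain ⟨S, hS, hfin⟩ := Group.fg_iff.mp hG
  obtain ⟨c, hc⟩ := Group.IsNilpotent.nilpotent G
  obtain ⟨T, hST, hT⟩ := exists_isPolyGrowthSet_superset hfin hS c hfin (by simp [hc])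
  exact ⟨T, eq_top_iff.mpr (hS ▸ Subgroup.closure_mono hST), hT⟩

open scoped Pointwise in
/-- Growth in a group is bounded by growth in a subgroup of finite index. -/
theorem exists_growth_le_index_mul (H : Subgroup G) [H.FiniteIndex] (hS : S.Finite) {T : Set H}
    (hT : T.Finite) (hinv : ∀ x ∈ T, x⁻¹ ∈ T) (hTtop : Subgroup.closure T = ⊤) :
    ∃ L M : ℕ, ∀ n, growth S n ≤ H.index * growth T (n * L + M) := by
  have hlen (h : H) : ∃ n, h ∈ ball T n :=
    exists_mem_ball_of_mem_closure hinv (hTtop ▸ Subgroup.mem_top h)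
  choose len hlen using hlen
  have hrep (s : G) (q : G ⧸ H) : ((s • q).out)⁻¹ * (s * q.out) ∈ H := by
    rw [← QuotientGroup.eq, QuotientGroup.out_eq', ← smul_eq_mul, ← MulAction.Quotient.smul_mk,
      QuotientGroup.out_eq']
  have hone : ((1 : G) : G ⧸ H).out⁻¹ * 1 ∈ H := by
    rw [← QuotientGroup.eq, QuotientGroup.out_eq']
  let f : G × (G ⧸ H) → ℕ := fun x => len ⟨_, hrep x.1 x.2⟩
  obtain ⟨L, hL⟩ := ((hS.prod (Set.finite_univ (α := G ⧸ H))).image f).bddAbove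
  set M := len ⟨_, hone⟩
  refine ⟨L, M, fun n => ?_⟩
  have hsub : ball S n ⊆ Set.range (fun q : G ⧸ H => q.out) *
      (Subtype.val '' ball T (n * L + M)) := by
    intro g hg
    refine ball_induction (P := fun m g => g ∈ Set.range (fun q : G ⧸ H => q.out) *
      (Subtype.val '' ball T (m * L + M))) ?_ ?_ hg
    · exact fun m => ⟨_, ⟨((1 : G) : G ⧸ H), rfl⟩, _,
        ⟨_, ball_mono (by lia) (hlen ⟨_, hone⟩), rfl⟩, by simp⟩
    · rintro m s _ hs ⟨_, ⟨q, rfl⟩, _, ⟨h, hh, rfl⟩, rfl⟩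
      have hsL : len ⟨_, hrep s q⟩ ≤ L := hL ⟨(s, q), ⟨hs, Set.mem_univ _⟩, rfl⟩
      refine ⟨_, ⟨s • q, rfl⟩, _, ⟨⟨_, hrep s q⟩ * h, ?_, rfl⟩, ?_⟩
      · refine ball_mono ?_ (mul_mem_ball (hlen ⟨_, hrep s q⟩) hh)
        rw [Nat.succ_mul]
        lia
      · simp [mul_assoc]
  calc growth S n ≤ _ := Set.ncard_le_ncard hsub
        ((Set.finite_range _).mul ((finite_ball hT _).image _))
    _ ≤ _ := Set.natCard_mul_le
    _ ≤ _ := by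
      refine Nat.mul_le_mul ?_ (Set.ncard_image_le (finite_ball hT _))
      rw [← Set.image_univ, Subgroup.index]
      exact (Set.ncard_image_le Set.finite_univ).trans (Set.ncard_univ _).le

end Ball

theorem Group.FG.exists_isSymmGen {G : Type*} [Group G] (hfg : Group.FG G) :
    ∃ S : Finset G, IsSymmGen S := by
  classical
  obtain ⟨S, hS⟩ := hfg.out
  refine ⟨S ∪ S.image (·⁻¹), fun x hx => ?_, eq_top_iff.mpr ?_⟩
  · simp only [Finset.mem_union, Finset.mem_image] at hx ⊢
    rcases hx with hx | ⟨y, hy, rfl⟩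
    · exact Or.inr ⟨x, hx, rfl⟩
    · exact Or.inl (by simpa using hy)
  · rw [← hS]
    exact Subgroup.closure_mono (by simp)

/-- If a finitely generated group `G` contains a nilpotent subgroup of finite index,
then `G` has polynomial growth. -/
theorem stmt7 {G : Type*} [Group G] (hfg : Group.FG G)
    (h : ∃ H : Subgroup G, Group.IsNilpotent H ∧ H.FiniteIndex) :
    HasPolyGrowth G := by
  obtain ⟨H, hnil, hfin⟩ := h
  obtain ⟨S, hS⟩ := hfg.exists_isSymmGen
  obtain ⟨T, hTtop, hT⟩ := exists_isPolyGrowthSet_closure_eq_top (G := H)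
  obtain ⟨L, M, hLM⟩ := exists_growth_le_index_mul H S.finite_toSet hT.finite hT.inv_mem hTtop
  obtain ⟨p, hp⟩ := hT.growth_le
  obtain ⟨C, k, hC, hCk⟩ := Polynomial.exists_eval_le_mul_pow_nat
    (Polynomial.C H.index * p.comp (Polynomial.X * Polynomial.C L + Polynomial.C M))
  refine ⟨S, hS, C, by exact_mod_cast hC, k, fun n hn => ?_⟩
  have h : growth (S : Set G) n ≤ C * n ^ k := by
    refine ((hLM n).trans (Nat.mul_le_mul_left _ (hp _))).trans ?_
    simpa using hCk n hn
  exact_mod_cast h
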